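/- arXiv:2005.09235 — 8 statements merged into one kernel-verified Lean document; each statement's English description precedes it below -/
import Mathlib

section
/- In the exchange-algorithm setup, for all θ, θ' ∈ Θ with θ ≠ θ', the off-diagonal transition densities satisfy p_EX(θ,θ') ≤ p_MH(θ,θ'); that is, the exchange kernel is dominated by the Metropolis–Hastings kernel in Peskun's ordering. -/
open MeasureTheory

/-- **Peskun domination of the exchange algorithm by Metropolis–Hastings.**
In the exchange-algorithm setup, for all `θ ≠ θ'` the off-diagonal transition
densities satisfy `p_EX(θ,θ') ≤ p_MH(θ,θ')`. -/
theorem exchange_le_MH_density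
    {Θ 𝒳 : Type*} [MeasurableSpace Θ] [MeasurableSpace 𝒳]
    (μ : Measure Θ) (ν : Measure 𝒳) [SigmaFinite μ] [SigmaFinite ν]
    (f : Θ → 𝒳 → ℝ)
    (hf_meas : Measurable (Function.uncurry f))
    (hf_pos : ∀ θ w, 0 < f θ w)
    (hf_int : ∀ θ, Integrable (f θ) ν)
    (Z : Θ → ℝ) (hZ : ∀ θ, Z θ = ∫ w, f θ w ∂ν) (hZ_pos : ∀ θ, 0 < Z θ)
    (p : Θ → 𝒳 → ℝ) (hp : ∀ θ w, p θ w = f θ w / Z θ)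
    (x : 𝒳)
    (prior : Θ → ℝ) (hprior_pos : ∀ θ, 0 < prior θ)
    (q : Θ → Θ → ℝ) (hq_pos : ∀ θ θ', 0 < q θ θ')
    (aMH : Θ → Θ → ℝ)
    (haMH : ∀ θ θ', aMH θ θ' =
      (prior θ' * q θ' θ * f θ' x * Z θ) / (prior θ * q θ θ' * f θ x * Z θ'))
    (aEX : Θ → Θ → 𝒳 → ℝ)
    (haEX : ∀ θ θ' w, aEX θ θ' w =
      (prior θ' * q θ' θ * f θ' x * f θ w) / (prior θ * q θ θ' * f θ x * f θ' w))
    (pMH : Θ → Θ → ℝ) (hpMH : ∀ θ θ', pMH θ θ' = q θ θ' * min 1 (aMH θ θ'))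
    (pEX : Θ → Θ → ℝ)
    (hpEX : ∀ θ θ', pEX θ θ' = q θ θ' * ∫ w, min 1 (aEX θ θ' w) * p θ' w ∂ν) :
    ∀ θ θ' : Θ, θ ≠ θ' → pEX θ θ' ≤ pMH θ θ' := by
  intro θ θ' _
  have aEX_pos (w : 𝒳) : 0 < aEX θ θ' w := by
    rw [haEX]
    have := hprior_pos θ
    have := hprior_pos θ'
    have := hq_pos θ θ'
    have := hq_pos θ' θ
    have := hf_pos θ x
    have := hf_pos θ' x
    have := hf_pos θ w
    have := hf_pos θ' w
    positivity
  have p_pos (w : 𝒳) : 0 < p θ' w := by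
    rw [hp]
    exact div_pos (hf_pos θ' w) (hZ_pos θ')
  have integrand_nonneg : 0 ≤ᵐ[ν] fun w => min 1 (aEX θ θ' w) * p θ' w :=
    .of_forall fun w => mul_nonneg (le_min zero_le_one (aEX_pos w).le) (p_pos w).le
  rw [hpEX, hpMH]
  refine mul_le_mul_of_nonneg_left (le_min ?_ ?_) (hq_pos θ θ').le
  · calc ∫ w, min 1 (aEX θ θ' w) * p θ' w ∂ν
        ≤ ∫ w, f θ' w / Z θ' ∂ν := by
          refine integral_mono_of_nonneg integrand_nonneg ((hf_int θ').div_const _)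
            (.of_forall fun w => ?_)
          simpa only [← hp, one_mul] using
            mul_le_mul_of_nonneg_right (min_le_left 1 (aEX θ θ' w)) (p_pos w).le
      _ = 1 := by rw [integral_div, ← hZ, div_self (hZ_pos θ').ne']
  · calc ∫ w, min 1 (aEX θ θ' w) * p θ' w ∂ν
        ≤ ∫ w, (prior θ' * q θ' θ * f θ' x) / (prior θ * q θ θ' * f θ x * Z θ') * f θ w ∂ν := by
          refine integral_mono_of_nonneg integrand_nonneg ((hf_int θ).const_mul _)
            (.of_forall fun w => ?_)
          refine (mul_le_mul_of_nonneg_right (min_le_right 1 (aEX θ θ' w)) (p_pos w).le).trans_eq ?_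
          have := (hf_pos θ' w).ne'
          rw [haEX, hp]
          field_simp
      _ = aMH θ θ' := by rw [integral_const_mul, ← hZ, haMH, div_mul_eq_mul_div]
end

section
/- Let P and Q be Markov kernels on a measurable space, both reversible with respect to a probability measure π, such that Q is dominated by P in Peskun's ordering. If Q is uniformly ergodic, then for every λ ∈ (0,1) the lazy kernel P_λ := λ·P + (1−λ)·Id, where Id(x,·) is the point mass at x, is uniformly ergodic. -/
open MeasureTheory ProbabilityTheory

/-- Total variation distance between two measures. -/
noncomputable def tvDist {α : Type*} [MeasurableSpace α] (μ ν : Measure α) : ℝ :=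
  ⨆ A : {s : Set α // MeasurableSet s}, |(μ A.1).toReal - (ν A.1).toReal|

/-- `n`-fold iterate of a Markov kernel. -/
noncomputable def kpow {α : Type*} [MeasurableSpace α] (P : Kernel α α) : ℕ → Kernel α α
  | 0 => Kernel.id
  | n + 1 => (kpow P n) ∘ₖ P

/-- Reversibility of a kernel with respect to a measure. -/
def Reversible {α : Type*} [MeasurableSpace α] (P : Kernel α α) (π : Measure α) : Prop :=
  ∀ A B : Set α, MeasurableSet A → MeasurableSet B →
    ∫⁻ x in A, P x B ∂π = ∫⁻ x in B, P x A ∂π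

/-- A kernel `Q` is dominated by `P` in Peskun's ordering. -/
def PeskunDom {α : Type*} [MeasurableSpace α] (P Q : Kernel α α) : Prop :=
  ∀ x : α, ∀ A : Set α, MeasurableSet A → Q x (A \ {x}) ≤ P x (A \ {x})

/-- Geometric ergodicity of a Markov kernel with stationary distribution `π`. -/
def GeomErgodic {α : Type*} [MeasurableSpace α] (P : Kernel α α) (π : Measure α) : Prop :=
  ∃ ρ : ℝ, ρ ∈ Set.Ioo (0:ℝ) 1 ∧ ∃ C : α → ℝ,
    ∀ᵐ x ∂π, ∀ n : ℕ, 1 ≤ n → tvDist ((kpow P n) x) π ≤ C x * ρ ^ n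

/-- Uniform ergodicity of a Markov kernel with stationary distribution `π`. -/
def UnifErgodic {α : Type*} [MeasurableSpace α] (P : Kernel α α) (π : Measure α) : Prop :=
  ∃ ρ : ℝ, ρ ∈ Set.Ioo (0:ℝ) 1 ∧ ∃ C : ℝ,
    ∀ᵐ x ∂π, ∀ n : ℕ, 1 ≤ n → tvDist ((kpow P n) x) π ≤ C * ρ ^ n

section KernelPowers

variable {α : Type*} [MeasurableSpace α]

instance isMarkovKernel_kpow (P : Kernel α α) [IsMarkovKernel P] (n : ℕ) :
    IsMarkovKernel (kpow P n) := by
  induction n with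
  | zero => unfold kpow; infer_instance
  | succ n ih => unfold kpow; infer_instance

lemma kpow_succ_apply (P : Kernel α α) (n : ℕ) (x : α) {A : Set α} (hA : MeasurableSet A) :
    kpow P (n + 1) x A = ∫⁻ y, kpow P n y A ∂(P x) :=
  Kernel.comp_apply' _ _ _ hA

lemma kpow_add (P : Kernel α α) (m n : ℕ) : kpow P (m + n) = kpow P m ∘ₖ kpow P n := by
  induction n with
  | zero => simp [kpow]
  | succ n ih => rw [← add_assoc, kpow, ih, kpow, Kernel.comp_assoc]

lemma measurable_kpow_toReal (P : Kernel α α) (n : ℕ) {A : Set α} (hA : MeasurableSet A) :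
    Measurable fun y => (kpow P n y A).toReal :=
  (Kernel.measurable_coe _ hA).ennreal_toReal

lemma kpow_add_toReal (P : Kernel α α) [IsMarkovKernel P] (m n : ℕ) (x : α) {A : Set α}
    (hA : MeasurableSet A) :
    (kpow P (m + n) x A).toReal = ∫ y, (kpow P m y A).toReal ∂(kpow P n x) := by
  rw [kpow_add, Kernel.comp_apply' _ _ _ hA,
    integral_toReal (Kernel.measurable_coe _ hA).aemeasurable (by simp)]

/-- A pointwise minorization `c • Q ≤ R` passes to the iterates. -/
lemma pow_mul_kpow_le {Q R : Kernel α α} {c : ENNReal}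
    (h : ∀ x A, MeasurableSet A → c * Q x A ≤ R x A) (n : ℕ) (x : α) {A : Set α}
    (hA : MeasurableSet A) : c ^ n * kpow Q n x A ≤ kpow R n x A := by
  induction n generalizing x with
  | zero => simp [kpow]
  | succ n ih =>
    have hle : c • Q x ≤ R x := Measure.le_iff.2 fun B hB => by simpa using h x B hB
    rw [kpow_succ_apply _ _ _ hA, kpow_succ_apply _ _ _ hA]
    calc c ^ (n + 1) * ∫⁻ y, kpow Q n y A ∂(Q x)
        = ∫⁻ y, c ^ n * kpow Q n y A ∂(c • Q x) := by
          rw [lintegral_smul_measure, lintegral_const_mul _ (Kernel.measurable_coe _ hA),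
            smul_eq_mul]
          ring
      _ ≤ ∫⁻ y, kpow R n y A ∂(R x) := lintegral_mono' hle fun y => ih y

lemma Reversible.lintegral_eq {P : Kernel α α} [IsMarkovKernel P] {π : Measure α}
    (h : Reversible P π) {B : Set α} (hB : MeasurableSet B) : ∫⁻ x, P x B ∂π = π B := by
  simpa using h Set.univ B MeasurableSet.univ hB

lemma lintegral_kpow_eq {P : Kernel α α} {π : Measure α}
    (h : ∀ B, MeasurableSet B → ∫⁻ x, P x B ∂π = π B) (n : ℕ) {B : Set α}
    (hB : MeasurableSet B) : ∫⁻ x, kpow P n x B ∂π = π B := by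
  induction n generalizing B with
  | zero => simp [kpow, Kernel.id_apply, hB, Measure.dirac_apply']
  | succ n ih =>
    have hbind : π.bind P = π := Measure.ext fun C hC => by
      rw [Measure.bind_apply hC P.aemeasurable, h C hC]
    simp_rw [kpow_succ_apply P n _ hB]
    rw [← Measure.lintegral_bind P.aemeasurable (Kernel.measurable_coe _ hB).aemeasurable,
      hbind, ih hB]

/-- Every property holding almost everywhere for an invariant measure holds on a conull
measurable set that the chain does not leave. -/
lemma exists_absorbing {P : Kernel α α} {π : Measure α}
    (h : ∀ B, MeasurableSet B → ∫⁻ x, P x B ∂π = π B) {p : α → Prop} (hp : ∀ᵐ x ∂π, p x) :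
    ∃ G : Set α, (∀ᵐ x ∂π, x ∈ G) ∧ (∀ x ∈ G, p x) ∧
      ∀ x ∈ G, ∀ n, ∀ᵐ y ∂(kpow P n x), y ∈ G := by
  obtain ⟨N, hsub, hN, hN0⟩ := exists_measurable_superset_of_null (ae_iff.1 hp)
  refine ⟨{x | ∀ n, kpow P n x N = 0}, ?_, fun x hx => ?_, fun x hx n => ?_⟩
  · refine ae_all_iff.2 fun n => ?_
    exact (lintegral_eq_zero_iff (Kernel.measurable_coe _ hN)).1
      ((lintegral_kpow_eq h n hN).trans hN0)
  · by_contra hpx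
    have h0 := hx 0
    simp [kpow, Kernel.id_apply, Measure.dirac_apply', hN, hsub hpx] at h0
  · refine ae_all_iff.2 fun m => ?_
    refine (lintegral_eq_zero_iff (Kernel.measurable_coe _ hN)).1 ?_
    rw [← Kernel.comp_apply' _ _ _ hN, ← kpow_add]
    exact hx (m + n)

end KernelPowers

section TotalVariation

variable {α : Type*} [MeasurableSpace α]

lemma abs_sub_le_tvDist (μ ν : Measure α) [IsProbabilityMeasure μ] [IsProbabilityMeasure ν]
    {A : Set α} (hA : MeasurableSet A) : |(μ A).toReal - (ν A).toReal| ≤ tvDist μ ν := by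
  refine le_ciSup (f := fun A : {s : Set α // MeasurableSet s} =>
    |(μ A.1).toReal - (ν A.1).toReal|) ⟨1, ?_⟩ ⟨A, hA⟩
  rintro _ ⟨B, rfl⟩
  exact abs_sub_le_of_nonneg_of_le measureReal_nonneg measureReal_le_one
    measureReal_nonneg measureReal_le_one

lemma tvDist_le {μ ν : Measure α} {c : ℝ}
    (h : ∀ A, MeasurableSet A → |(μ A).toReal - (ν A).toReal| ≤ c) : tvDist μ ν ≤ c :=
  haveI : Nonempty {s : Set α // MeasurableSet s} := ⟨⟨∅, MeasurableSet.empty⟩⟩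
  ciSup_le fun A => h A.1 A.2

/-- Two measures that differ by at most `e` on events give integrals differing by at most `d * e`
on functions with oscillation at most `d`. -/
lemma integral_sub_integral_le {μ ν : Measure α} [IsProbabilityMeasure μ]
    [IsProbabilityMeasure ν] {G : Set α} (hμ : ∀ᵐ y ∂μ, y ∈ G) (hν : ∀ᵐ y ∂ν, y ∈ G)
    {f : α → ℝ} (hf : Measurable f) (hf0 : ∀ y, 0 ≤ f y) {d e : ℝ} (hd : 0 ≤ d)
    (hosc : ∀ x ∈ G, ∀ y ∈ G, f x - f y ≤ d)
    (hμν : ∀ B, MeasurableSet B → (μ B).toReal - (ν B).toReal ≤ e) :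
    ∫ y, f y ∂μ - ∫ y, f y ∂ν ≤ d * e := by
  obtain ⟨z, hz⟩ := hμ.exists
  set a := sInf (f '' G)
  have hbdd : BddBelow (f '' G) := ⟨0, by rintro _ ⟨y, -, rfl⟩; exact hf0 y⟩
  have hlow : ∀ y ∈ G, 0 ≤ f y - a := fun y hy =>
    sub_nonneg.2 (csInf_le hbdd ⟨y, hy, rfl⟩)
  have hup : ∀ y ∈ G, f y - a ≤ d := fun y hy => by
    have : f y - d ≤ a := by
      refine le_csInf ⟨_, z, hz, rfl⟩ ?_
      rintro _ ⟨w, hw, rfl⟩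
      linarith [hosc y hy w hw]
    linarith
  have key : ∀ κ : Measure α, IsProbabilityMeasure κ → (∀ᵐ y ∂κ, y ∈ G) →
      ∫ y, f y ∂κ = a + ∫ t in Set.Ioc 0 d, κ.real {y | t ≤ f y - a} := by
    intro κ _ hκ
    have hint : Integrable (fun y => f y - a) κ := by
      refine Integrable.of_bound (hf.sub_const a).aestronglyMeasurable d ?_
      filter_upwards [hκ] with y hy
      rw [Real.norm_of_nonneg (hlow y hy)]
      exact hup y hy
    have hcake := hint.integral_eq_integral_Ioc_meas_le (M := d)
      (by filter_upwards [hκ] with y hy using hlow y hy)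
      (by filter_upwards [hκ] with y hy using hup y hy)
    have hfint : Integrable f κ := 
      (hint.add (integrable_const a)).congr (ae_of_all _ fun y => sub_add_cancel (f y) a)
    rw [integral_sub hfint (integrable_const a)] at hcake
    simp only [integral_const, probReal_univ, one_smul] at hcake
    linarith
  have hint : ∀ κ : Measure α, IsProbabilityMeasure κ →
      IntegrableOn (fun t => κ.real {y | t ≤ f y - a}) (Set.Ioc 0 d) := by
    intro κ _
    have hanti : Antitone fun t => κ.real {y | t ≤ f y - a} := fun s t hst =>
      measureReal_mono fun y (hy : t ≤ f y - a) => hst.trans hy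
    refine Integrable.of_bound hanti.measurable.aestronglyMeasurable 1 (ae_of_all _ fun t => ?_)
    rw [Real.norm_of_nonneg measureReal_nonneg]
    exact measureReal_le_one
  rw [key μ ‹_› hμ, key ν ‹_› hν, add_sub_add_left_eq_sub, ← integral_sub (hint μ ‹_›) (hint ν ‹_›)]
  calc _ ≤ ∫ _ in Set.Ioc 0 d, e := by
        refine integral_mono ((hint μ ‹_›).sub (hint ν ‹_›)) (integrable_const e) fun t => ?_
        exact hμν _ (measurableSet_le measurable_const (hf.sub_const a))
    _ = d * e := by simp [hd]

end TotalVariation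

section Dobrushin

variable {α : Type*} [MeasurableSpace α]

/-- The Dobrushin coefficient of `P ^ n` restricted to the starting points in `G` is at most `d`. -/
def OscBound (P : Kernel α α) (G : Set α) (n : ℕ) (d : ℝ) : Prop :=
  ∀ x ∈ G, ∀ y ∈ G, ∀ A, MeasurableSet A →
    (kpow P n x A).toReal - (kpow P n y A).toReal ≤ d

variable {P : Kernel α α} [IsMarkovKernel P] {G : Set α}

lemma oscBound_one (n : ℕ) : OscBound P G n 1 := fun x _ _ _ _ _ =>
  (sub_le_self _ ENNReal.toReal_nonneg).trans (measureReal_le_one (μ := kpow P n x))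

lemma OscBound.add (hG : ∀ x ∈ G, ∀ n, ∀ᵐ y ∂(kpow P n x), y ∈ G) {m n : ℕ} {d e : ℝ}
    (hd : 0 ≤ d) (hm : OscBound P G m d) (hn : OscBound P G n e) :
    OscBound P G (m + n) (d * e) := fun x hx y hy A hA => by
  rw [kpow_add_toReal P m n x hA, kpow_add_toReal P m n y hA]
  exact integral_sub_integral_le (hG x hx n) (hG y hy n) (measurable_kpow_toReal P m hA)
    (fun _ => ENNReal.toReal_nonneg) hd (fun u hu v hv => hm u hu v hv A hA)
    fun B hB => hn x hx y hy B hB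

lemma OscBound.mul (hG : ∀ x ∈ G, ∀ n, ∀ᵐ y ∂(kpow P n x), y ∈ G) {n : ℕ} {d : ℝ}
    (hd : 0 ≤ d) (hn : OscBound P G n d) (k : ℕ) : OscBound P G (n * k) (d ^ k) := by
  induction k with
  | zero => simpa using oscBound_one 0
  | succ k ih => exact OscBound.add hG (pow_nonneg hd k) ih hn

lemma OscBound.tvDist_le {π : Measure α} [IsProbabilityMeasure π]
    (hπ : ∀ B, MeasurableSet B → ∫⁻ x, P x B ∂π = π B) (hGπ : ∀ᵐ x ∂π, x ∈ G) {n : ℕ} {d : ℝ}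
    (h : OscBound P G n d) {x : α} (hx : x ∈ G) : tvDist (kpow P n x) π ≤ d := by
  refine _root_.tvDist_le fun A hA => ?_
  have hint : Integrable (fun y => (kpow P n y A).toReal) π :=
    Integrable.of_bound (measurable_kpow_toReal P n hA).aestronglyMeasurable 1
      (ae_of_all _ fun y => by
        rw [Real.norm_of_nonneg ENNReal.toReal_nonneg]
        exact measureReal_le_one (μ := kpow P n y))
  have hinv : (π A).toReal = ∫ y, (kpow P n y A).toReal ∂π := by
    rw [integral_toReal (Kernel.measurable_coe _ hA).aemeasurable (by simp),
      lintegral_kpow_eq hπ n hA]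
  have hlow : (kpow P n x A).toReal - d ≤ ∫ y, (kpow P n y A).toReal ∂π := by
    calc (kpow P n x A).toReal - d = ∫ _, ((kpow P n x A).toReal - d) ∂π := by simp
      _ ≤ _ := integral_mono_ae (integrable_const _) hint (by
        filter_upwards [hGπ] with y hy
        linarith [h x hx y hy A hA])
  have hup : ∫ y, (kpow P n y A).toReal ∂π ≤ (kpow P n x A).toReal + d := by
    calc _ ≤ ∫ _, ((kpow P n x A).toReal + d) ∂π := integral_mono_ae hint (integrable_const _) (by
        filter_upwards [hGπ] with y hy
        linarith [h y hy x hx A hA])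
      _ = _ := by simp
  rw [hinv, abs_le]
  constructor <;> linarith

lemma UnifErgodic.of_oscBound {π : Measure α} [IsProbabilityMeasure π]
    (hπ : ∀ B, MeasurableSet B → ∫⁻ x, P x B ∂π = π B) (hGπ : ∀ᵐ x ∂π, x ∈ G)
    (hG : ∀ x ∈ G, ∀ n, ∀ᵐ y ∂(kpow P n x), y ∈ G) {n : ℕ} (hn : n ≠ 0) {d : ℝ}
    (hd0 : 0 < d) (hd1 : d < 1) (h : OscBound P G n d) : UnifErgodic P π := by
  set ρ : ℝ := d ^ (n⁻¹ : ℝ)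
  have hρ0 : 0 < ρ := Real.rpow_pos_of_pos hd0 _
  have hρ1 : ρ < 1 := Real.rpow_lt_one hd0.le hd1 (by positivity)
  have hρn : ρ ^ n = d := Real.rpow_inv_natCast_pow hd0.le hn
  refine ⟨ρ, ⟨hρ0, hρ1⟩, d⁻¹, ?_⟩
  filter_upwards [hGπ] with x hx m _
  have hosc : OscBound P G m (d ^ (m / n)) := by
    have := OscBound.add hG (pow_nonneg hd0.le _) (h.mul hG hd0.le (m / n)) (oscBound_one (m % n))
    rwa [Nat.div_add_mod, mul_one] at this
  refine (hosc.tvDist_le hπ hGπ hx).trans ?_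
  rw [le_inv_mul_iff₀ hd0, ← pow_succ', ← hρn, ← pow_mul]
  exact pow_le_pow_of_le_one hρ0.le hρ1.le (Nat.lt_mul_div_succ m (Nat.pos_of_ne_zero hn)).le

end Dobrushin

/-- A kernel bounded below by a multiple of a uniformly ergodic kernel with the same invariant
measure is uniformly ergodic. -/
lemma UnifErgodic.of_minorization {α : Type*} [MeasurableSpace α] {π : Measure α}
    [IsProbabilityMeasure π] {Q R : Kernel α α} [IsMarkovKernel Q] [IsMarkovKernel R]
    (hπ : ∀ B, MeasurableSet B → ∫⁻ x, R x B ∂π = π B) {ε : ℝ} (hε : 0 < ε)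
    (h : ∀ x A, MeasurableSet A → ENNReal.ofReal ε * Q x A ≤ R x A)
    (hQ : UnifErgodic Q π) : UnifErgodic R π := by
  obtain ⟨ρ, ⟨hρ0, hρ1⟩, C, hC⟩ := hQ
  obtain ⟨n, hn, hCn⟩ : ∃ n : ℕ, 1 ≤ n ∧ C * ρ ^ n < 1 / 4 := by
    have hlim : Filter.Tendsto (fun n : ℕ => C * ρ ^ n) Filter.atTop (nhds 0) := by
      simpa using (tendsto_pow_atTop_nhds_zero_of_lt_one hρ0.le hρ1).const_mul C
    exact ((Filter.eventually_ge_atTop 1).and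
      (hlim.eventually_lt_const (by norm_num : (0 : ℝ) < 1 / 4))).exists
  obtain ⟨G, hGπ, hGQ, hG⟩ := exists_absorbing hπ hC
  have hlow : ∀ x ∈ G, ∀ A, MeasurableSet A →
      ε ^ n * ((π A).toReal - 1 / 4) ≤ (kpow R n x A).toReal := by
    intro x hx A hA
    have h1 := (abs_le.1 ((abs_sub_le_tvDist (kpow Q n x) π hA).trans (hGQ x hx n hn))).1
    have h2 := ENNReal.toReal_mono (measure_ne_top _ _) (pow_mul_kpow_le h n x hA)
    rw [ENNReal.toReal_mul, ENNReal.toReal_pow, ENNReal.toReal_ofReal hε.le] at h2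
    refine le_trans ?_ h2
    gcongr
    linarith
  have hεn : 0 < ε ^ n := pow_pos hε n
  have hε1 : ε ≤ 1 := by
    obtain ⟨x, -⟩ := hGπ.exists
    have := h x Set.univ MeasurableSet.univ
    simpa using this
  have hεn1 : ε ^ n ≤ 1 := pow_le_one₀ hε.le hε1
  refine UnifErgodic.of_oscBound hπ hGπ hG (n := n) (d := 1 - ε ^ n / 2) (by omega) (by linarith)
    (by linarith) fun x hx y hy A hA => ?_
  have hxA := hlow x hx Aᶜ hA.compl
  have hyA := hlow y hy A hA
  have hπc : (π Aᶜ).toReal = 1 - (π A).toReal := probReal_compl_eq_one_sub hA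
  have hxc : (kpow R n x Aᶜ).toReal = 1 - (kpow R n x A).toReal := probReal_compl_eq_one_sub hA
  rw [hπc, hxc] at hxA
  linarith

/-- **Uniform ergodicity of the dominated chain implies uniform ergodicity of every
lazy version of the dominating chain.** -/
theorem lazy_unifErgodic_of_dominated_unifErgodic
    {α : Type*} [MeasurableSpace α] (π : Measure α) [IsProbabilityMeasure π]
    (P Q : Kernel α α) [IsMarkovKernel P] [IsMarkovKernel Q]
    (hPrev : Reversible P π) (hQrev : Reversible Q π)
    (hdom : PeskunDom P Q)
    (hQ : UnifErgodic Q π) :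
    ∀ lam : ℝ, lam ∈ Set.Ioo (0:ℝ) 1 →
      ∀ Plam : Kernel α α, IsMarkovKernel Plam →
        (∀ x : α, Plam x =
          ENNReal.ofReal lam • P x + ENNReal.ofReal (1 - lam) • Measure.dirac x) →
        UnifErgodic Plam π := by
  rintro lam ⟨hlam0, hlam1⟩ Plam _ hPlam
  have happ : ∀ x B, Plam x B = ENNReal.ofReal lam * P x B +
      ENNReal.ofReal (1 - lam) * Measure.dirac x B := fun x B => by simp [hPlam x]
  refine UnifErgodic.of_minorization (ε := min lam (1 - lam)) (fun B hB => ?_)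
    (lt_min hlam0 (sub_pos.2 hlam1)) (fun x A hA => ?_) hQ
  · have hdirac : ∫⁻ x, Measure.dirac x B ∂π = π B := by
      simp [Measure.dirac_apply', hB]
    have hP := P.measurable_coe hB
    simp_rw [happ]
    rw [lintegral_add_left (hP.const_mul _), lintegral_const_mul _ hP,
      lintegral_const_mul' _ _ ENNReal.ofReal_ne_top, hPrev.lintegral_eq hB, hdirac, ← add_mul,
      ← ENNReal.ofReal_add hlam0.le (sub_pos.2 hlam1).le]
    simp
  · rw [happ]
    by_cases hx : x ∈ A
    · refine le_add_left ?_
      rw [Measure.dirac_apply_of_mem hx]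
      gcongr
      · exact min_le_right _ _
      · exact prob_le_one
    · have hQP := hdom x A hA
      rw [Set.sdiff_singleton_eq_self hx] at hQP
      refine le_add_right ?_
      gcongr
      exact min_le_left _ _
end

section
/- Fix x ≥ 0. For θ, θ' > 0 with θ ≠ θ', let w₀(θ,θ') := (log θ − log θ')/(θ − θ'). Define F(θ) := ∫₀^∞ (x+1)² θ' e^{−(x+1)θ'} · (e^{−w₀(θ,θ')·min(θ,θ')} − e^{−w₀(θ,θ')·max(θ,θ')}) dθ'. Then F(θ) → 1 as θ → ∞. -/
open MeasureTheory Set Filter Topology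

theorem log_sub_log_div_sub_nonneg {a b : ℝ} (ha : 0 < a) (hb : 0 < b) :
    0 ≤ (Real.log a - Real.log b) / (a - b) := by
  rcases le_total a b with h | h
  · exact div_nonneg_of_nonpos (sub_nonpos.2 (Real.log_le_log ha h)) (sub_nonpos.2 h)
  · exact div_nonneg (sub_nonneg.2 (Real.log_le_log hb h)) (sub_nonneg.2 h)

theorem abs_exp_neg_sub_exp_neg_le_one {s t : ℝ} (hs : 0 ≤ s) (ht : 0 ≤ t) :
    |Real.exp (-s) - Real.exp (-t)| ≤ 1 := by
  have h₁ : Real.exp (-s) ≤ 1 := Real.exp_le_one_iff.2 (neg_nonpos.2 hs)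
  have h₂ : Real.exp (-t) ≤ 1 := Real.exp_le_one_iff.2 (neg_nonpos.2 ht)
  rw [abs_le]
  constructor <;> linarith [Real.exp_pos (-s), Real.exp_pos (-t)]

/-- The `Gamma(2, r)` density integrates to one. -/
theorem integral_sq_mul_mul_exp_neg_mul_Ioi {r : ℝ} (hr : 0 < r) :
    ∫ t in Ioi (0 : ℝ), r ^ 2 * t * Real.exp (-r * t) = 1 := by
  have h := Real.integral_rpow_mul_exp_neg_mul_Ioi (a := 2) two_pos hr
  have hΓ : Real.Gamma 2 = 1 := Real.Gamma_two
  norm_num [hΓ] at h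
  simp only [mul_assoc, neg_mul, integral_const_mul, h]
  field_simp

theorem integrableOn_sq_mul_mul_exp_neg_mul_Ioi {r : ℝ} (hr : 0 < r) :
    IntegrableOn (fun t : ℝ ↦ r ^ 2 * t * Real.exp (-r * t)) (Ioi 0) := by
  by_contra h
  have h₁ := integral_sq_mul_mul_exp_neg_mul_Ioi hr
  rw [integral_undef h] at h₁
  exact zero_ne_one h₁

theorem tendsto_div_sub_const_atTop (b : ℝ) :
    Tendsto (fun a : ℝ ↦ a / (a - b)) atTop (𝓝 1) := by
  have h : Tendsto (fun a : ℝ ↦ 1 + b * (a - b)⁻¹) atTop (𝓝 (1 + b * 0)) :=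
    ((tendsto_inv_atTop_zero.comp (tendsto_atTop_add_const_right _ (-b) tendsto_id)).const_mul
      b).const_add 1
  rw [mul_zero, add_zero] at h
  refine h.congr' ?_
  filter_upwards [eventually_gt_atTop b] with a ha
  have : a - b ≠ 0 := (sub_pos.2 ha).ne'
  field_simp
  ring

theorem tendsto_log_sub_log_div_sub_atTop (b : ℝ) :
    Tendsto (fun a : ℝ ↦ (Real.log a - Real.log b) / (a - b)) atTop (𝓝 0) := by
  have h : Tendsto (fun a : ℝ ↦ (Real.log a / a - Real.log b / a) * (a / (a - b))) atTop
      (𝓝 ((0 - 0) * 1)) :=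
    ((Real.isLittleO_log_id_atTop.tendsto_div_nhds_zero).sub
      (tendsto_const_nhds.div_atTop tendsto_id)).mul (tendsto_div_sub_const_atTop b)
  rw [sub_zero, zero_mul] at h
  refine h.congr' ?_
  filter_upwards [eventually_gt_atTop 0, eventually_gt_atTop b] with a ha hab
  have : a - b ≠ 0 := (sub_pos.2 hab).ne'
  field_simp

theorem tendsto_log_sub_log_div_sub_mul_atTop (b : ℝ) :
    Tendsto (fun a : ℝ ↦ (Real.log a - Real.log b) / (a - b) * a) atTop atTop := by
  have h : Tendsto (fun a : ℝ ↦ (Real.log a - Real.log b) * (a / (a - b))) atTop atTop :=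
    (tendsto_atTop_add_const_right _ (-Real.log b) Real.tendsto_log_atTop).atTop_mul_pos
      one_pos (tendsto_div_sub_const_atTop b)
  exact h.congr fun a ↦ by ring

/-- **The rejection probability of the exchange algorithm for the
exponential-likelihood / Gamma-posterior model tends to `1`.** -/
theorem exchange_rejection_tendsto_one
    (x : ℝ) (hx : 0 ≤ x)
    (w₀ : ℝ → ℝ → ℝ)
    (hw₀ : ∀ θ θ' : ℝ, θ ≠ θ' →
      w₀ θ θ' = (Real.log θ - Real.log θ') / (θ - θ'))
    (F : ℝ → ℝ)
    (hF : ∀ θ : ℝ, F θ = ∫ θ' in Set.Ioi (0:ℝ),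
      (x + 1) ^ 2 * θ' * Real.exp (-(x + 1) * θ') *
        (Real.exp (-(w₀ θ θ') * min θ θ') - Real.exp (-(w₀ θ θ') * max θ θ'))) :
    Filter.Tendsto F Filter.atTop (nhds 1) := by
  have hr : 0 < x + 1 := by linarith
  have hF' : F = fun θ ↦ ∫ θ' in Ioi (0:ℝ),
      (x + 1) ^ 2 * θ' * Real.exp (-(x + 1) * θ') *
        (Real.exp (-((Real.log θ - Real.log θ') / (θ - θ') * min θ θ')) -
          Real.exp (-((Real.log θ - Real.log θ') / (θ - θ') * max θ θ'))) := by
    funext θ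
    rw [hF]
    refine integral_congr_ae (ae_of_all _ fun θ' ↦ ?_)
    rcases eq_or_ne θ θ' with rfl | h
    · simp
    · simp only [hw₀ θ θ' h, neg_mul]
  rw [hF']
  conv => arg 3; rw [← integral_sq_mul_mul_exp_neg_mul_Ioi hr]
  refine tendsto_integral_filter_of_dominated_convergence
    (fun t ↦ (x + 1) ^ 2 * t * Real.exp (-(x + 1) * t)) ?_ ?_
    (integrableOn_sq_mul_mul_exp_neg_mul_Ioi hr) ?_
  · exact Eventually.of_forall fun θ ↦ Measurable.aestronglyMeasurable (by fun_prop)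
  · filter_upwards [eventually_gt_atTop 0] with θ hθ
    filter_upwards [ae_restrict_mem measurableSet_Ioi] with t (ht : 0 < t)
    have hw := log_sub_log_div_sub_nonneg hθ ht
    have hp : 0 ≤ (x + 1) ^ 2 * t * Real.exp (-(x + 1) * t) := by positivity
    rw [norm_mul, Real.norm_of_nonneg hp, Real.norm_eq_abs]
    exact mul_le_of_le_one_right hp (abs_exp_neg_sub_exp_neg_le_one
      (mul_nonneg hw (le_min hθ.le ht.le)) (mul_nonneg hw (le_max_of_le_left hθ.le)))
  · filter_upwards with t
    have h₁ := Real.continuous_exp.continuousAt.tendsto.comp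
      ((tendsto_log_sub_log_div_sub_atTop t).mul_const t).neg
    have h₂ := Real.tendsto_exp_neg_atTop_nhds_zero.comp (tendsto_log_sub_log_div_sub_mul_atTop t)
    have h := (h₁.sub h₂).const_mul ((x + 1) ^ 2 * t * Real.exp (-(x + 1) * t))
    simp only [zero_mul, neg_zero, Real.exp_zero, sub_zero, mul_one] at h
    refine h.congr' ?_
    filter_upwards [eventually_gt_atTop t] with θ hθ
    simp only [Function.comp_apply, min_eq_right hθ.le, max_eq_left hθ.le]
end

section
/- Let ν be a σ-finite measure on a measurable space and let p, p' be probability densities with respect to ν, with p' > 0 everywhere. Let R ≥ 0, let δ ∈ (0,1], and set A_δ := {w : p(w) > δ·p'(w)}. Then ∫ min{1, R·p(w)/p'(w)} p'(w) ν(dw) ≥ δ · (∫_{A_δ} p' dν) · min{1, R}. -/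
open MeasureTheory

/-- A truncated multiple of a density ratio dominates `δ * min 1 R` wherever the ratio
exceeds `δ`. -/
lemma mul_min_one_le_min_one_mul_div {R δ a b : ℝ} (hR : 0 ≤ R) (hδ₀ : 0 ≤ δ) (hδ₁ : δ ≤ 1)
    (hb : 0 < b) (h : δ * b ≤ a) : δ * min 1 R ≤ min 1 (R * a / b) := by
  have hmin : 0 ≤ min 1 R := le_min zero_le_one hR
  refine le_min ?_ ?_
  · exact mul_le_one₀ hδ₁ hmin (min_le_left _ _)
  · rw [le_div_iff₀ hb]
    calc δ * min 1 R * b = min 1 R * (δ * b) := by ring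
      _ ≤ R * a := mul_le_mul (min_le_right _ _) h (mul_nonneg hδ₀ hb.le) hR

/-- **Key acceptance-probability estimate for the exchange algorithm.**
If `A_δ = {w : p w > δ p' w}`, then the averaged exchange acceptance probability is
at least `δ · (∫_{A_δ} p' dν) · min{1, R}`. -/
theorem exchange_acceptance_lower_bound
    {𝒳 : Type*} [MeasurableSpace 𝒳] (ν : Measure 𝒳) [SigmaFinite ν]
    (p p' : 𝒳 → ℝ) (hp_meas : Measurable p) (hp'_meas : Measurable p')
    (hp_nonneg : ∀ w, 0 ≤ p w) (hp'_pos : ∀ w, 0 < p' w)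
    (hp_int : Integrable p ν) (hp'_int : Integrable p' ν)
    (hp_dens : ∫ w, p w ∂ν = 1) (hp'_dens : ∫ w, p' w ∂ν = 1)
    (R : ℝ) (hR : 0 ≤ R) (δ : ℝ) (hδ : δ ∈ Set.Ioc (0:ℝ) 1)
    (Aδ : Set 𝒳) (hAδ : Aδ = {w : 𝒳 | p w > δ * p' w}) :
    δ * (∫ w in Aδ, p' w ∂ν) * min 1 R ≤
      ∫ w, min 1 (R * p w / p' w) * p' w ∂ν := by
  subst hAδ
  have hnonneg : ∀ w, 0 ≤ min 1 (R * p w / p' w) * p' w := fun w =>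
    mul_nonneg (le_min zero_le_one
      (div_nonneg (mul_nonneg hR (hp_nonneg w)) (hp'_pos w).le)) (hp'_pos w).le
  have hint : Integrable (fun w => min 1 (R * p w / p' w) * p' w) ν := by
    refine hp'_int.mono' (by fun_prop) (Filter.Eventually.of_forall fun w => ?_)
    rw [Real.norm_of_nonneg (hnonneg w)]
    exact mul_le_of_le_one_left (hp'_pos w).le (min_le_left _ _)
  have hA : MeasurableSet {w | p w > δ * p' w} :=
    measurableSet_lt (hp'_meas.const_mul δ) hp_meas
  calc δ * (∫ w in {w | p w > δ * p' w}, p' w ∂ν) * min 1 R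
      = ∫ w in {w | p w > δ * p' w}, δ * min 1 R * p' w ∂ν := by
        rw [integral_const_mul]; ring
    _ ≤ ∫ w in {w | p w > δ * p' w}, min 1 (R * p w / p' w) * p' w ∂ν :=
        setIntegral_mono_on (hp'_int.const_mul _).integrableOn hint.integrableOn hA
          fun w hw => mul_le_mul_of_nonneg_right
            (mul_min_one_le_min_one_mul_div hR hδ.1.le hδ.2 (hp'_pos w) (le_of_lt hw))
            (hp'_pos w).le
    _ ≤ ∫ w, min 1 (R * p w / p' w) * p' w ∂ν :=
        setIntegral_le_integral hint (Filter.Eventually.of_forall hnonneg)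
end

section
/- Let ν be a σ-finite measure on a measurable space and let p, p' be probability densities with respect to ν, with p' > 0 everywhere. Then for every R ≥ 0, ∫ min{1, R·p(w)/p'(w)} p'(w) ν(dw) ≥ min{1, R} · ∫ min{p(w), p'(w)} ν(dw) = min{1, R} · (1 − ‖p·ν − p'·ν‖_TV), where p·ν and p'·ν denote the probability measures with densities p and p' with respect to ν. -/
open MeasureTheory

/-- The total variation distance is attained on the set where one density exceeds the other. -/
theorem tvDist_withDensity_ofReal {α : Type*} [MeasurableSpace α] (ν : Measure α) {f g : α → ℝ}
    (hf_meas : Measurable f) (hg_meas : Measurable g)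
    (hf_nonneg : ∀ w, 0 ≤ f w) (hg_nonneg : ∀ w, 0 ≤ g w)
    (hf : Integrable f ν) (hg : Integrable g ν) (hfg : ∫ w, f w ∂ν = ∫ w, g w ∂ν) :
    tvDist (ν.withDensity fun w => ENNReal.ofReal (f w))
        (ν.withDensity fun w => ENNReal.ofReal (g w)) =
      ∫ w, f w ∂ν - ∫ w, min (f w) (g w) ∂ν := by
  have toReal_withDensity : ∀ {h : α → ℝ}, (∀ w, 0 ≤ h w) → Integrable h ν →
      ∀ {s : Set α}, MeasurableSet s →
        ((ν.withDensity fun w => ENNReal.ofReal (h w)) s).toReal = ∫ w in s, h w ∂ν := by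
    intro h h_nonneg h_int s hs
    rw [withDensity_apply _ hs, integral_eq_lintegral_of_nonneg_ae
      (Filter.Eventually.of_forall h_nonneg) h_int.aestronglyMeasurable.restrict]
  have hmin : Integrable (fun w => min (f w) (g w)) ν := hf.inf hg
  have setIntegral_sub_le : ∀ {u v : α → ℝ}, Integrable u ν → Integrable v ν → ∀ {s : Set α},
      MeasurableSet s →
        ∫ w in s, u w ∂ν - ∫ w in s, v w ∂ν ≤ ∫ w, u w ∂ν - ∫ w, min (u w) (v w) ∂ν := by
    intro u v hu hv s hs
    have huv : Integrable (fun w => min (u w) (v w)) ν := hu.inf hv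
    rw [← integral_sub hu.integrableOn hv.integrableOn, ← integral_sub hu huv]
    calc ∫ w in s, (u w - v w) ∂ν ≤ ∫ w in s, (u w - min (u w) (v w)) ∂ν :=
          integral_mono (hu.sub hv).integrableOn (hu.sub huv).integrableOn
            fun w => sub_le_sub_left (min_le_right _ _) _
      _ ≤ ∫ w, (u w - min (u w) (v w)) ∂ν :=
          setIntegral_le_integral (hu.sub huv)
            (Filter.Eventually.of_forall fun w => sub_nonneg.2 (min_le_left _ _))
  have hle : ∀ A : {s : Set α // MeasurableSet s},
      |((ν.withDensity fun w => ENNReal.ofReal (f w)) A.1).toReal -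
        ((ν.withDensity fun w => ENNReal.ofReal (g w)) A.1).toReal| ≤
      ∫ w, f w ∂ν - ∫ w, min (f w) (g w) ∂ν := by
    rintro ⟨s, hs⟩
    rw [toReal_withDensity hf_nonneg hf hs, toReal_withDensity hg_nonneg hg hs, abs_le']
    refine ⟨setIntegral_sub_le hf hg hs, ?_⟩
    rw [neg_sub, hfg]
    simpa only [min_comm] using setIntegral_sub_le hg hf hs
  have hs : MeasurableSet {w | g w < f w} := measurableSet_lt hg_meas hf_meas
  have : Nonempty {s : Set α // MeasurableSet s} := ⟨⟨_, hs⟩⟩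
  refine le_antisymm (ciSup_le hle) ?_
  refine le_trans (le_of_eq ?_) (le_ciSup ⟨_, Set.forall_mem_range.2 hle⟩ ⟨_, hs⟩)
  have heq : ∫ w, f w ∂ν - ∫ w, min (f w) (g w) ∂ν =
      ∫ w in {w | g w < f w}, f w ∂ν - ∫ w in {w | g w < f w}, g w ∂ν := by
    rw [← integral_sub hf hmin, ← integral_sub hf.integrableOn hg.integrableOn,
      ← integral_indicator hs]
    refine integral_congr_ae (Filter.Eventually.of_forall fun w => ?_)
    by_cases hw : g w < f w
    · simp [Set.indicator, hw, hw.le]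
    · simp [Set.indicator, hw, not_lt.1 hw]
  have hnonneg : 0 ≤ ∫ w, f w ∂ν - ∫ w, min (f w) (g w) ∂ν :=
    sub_nonneg.2 (integral_mono hmin hf fun w => min_le_left _ _)
  dsimp only
  rw [toReal_withDensity hf_nonneg hf hs, toReal_withDensity hg_nonneg hg hs, ← heq,
    abs_of_nonneg hnonneg]

/-- Pointwise comparison behind the acceptance bound. -/
theorem min_one_mul_min_le {R a b : ℝ} (hR : 0 ≤ R) (ha : 0 ≤ a) (hb : 0 ≤ b) :
    min 1 R * min a b ≤ min b (R * a) :=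
  le_min
    ((mul_le_mul (min_le_left _ _) (min_le_right _ _) (le_min ha hb) zero_le_one).trans_eq
      (one_mul b))
    (mul_le_mul (min_le_right _ _) (min_le_left _ _) (le_min ha hb) hR)

/-- **Acceptance-probability bound via total variation.**
The averaged exchange acceptance probability is at least the Metropolis–Hastings
acceptance probability `min{1,R}` times the overlap `∫ min{p, p'} dν`, which equals
`min{1,R}·(1 − ‖p·ν − p'·ν‖_TV)`. -/
theorem exchange_acceptance_tv_lower_bound
    {𝒳 : Type*} [MeasurableSpace 𝒳] (ν : Measure 𝒳) [SigmaFinite ν]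
    (p p' : 𝒳 → ℝ) (hp_meas : Measurable p) (hp'_meas : Measurable p')
    (hp_nonneg : ∀ w, 0 ≤ p w) (hp'_pos : ∀ w, 0 < p' w)
    (hp_int : Integrable p ν) (hp'_int : Integrable p' ν)
    (hp_dens : ∫ w, p w ∂ν = 1) (hp'_dens : ∫ w, p' w ∂ν = 1)
    (Pmeas P'meas : Measure 𝒳)
    (hPmeas : Pmeas = ν.withDensity (fun w => ENNReal.ofReal (p w)))
    (hP'meas : P'meas = ν.withDensity (fun w => ENNReal.ofReal (p' w))) :
    ∀ R : ℝ, 0 ≤ R →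
      (min 1 R * ∫ w, min (p w) (p' w) ∂ν ≤
        ∫ w, min 1 (R * p w / p' w) * p' w ∂ν) ∧
      min 1 R * ∫ w, min (p w) (p' w) ∂ν =
        min 1 R * (1 - tvDist Pmeas P'meas) := by
  intro R hR
  refine ⟨?_, ?_⟩
  · have hmin : Integrable (fun w => min (p w) (p' w)) ν := hp_int.inf hp'_int
    have hacc : ∀ w, min 1 (R * p w / p' w) * p' w = min (p' w) (R * p w) := fun w => by
      rw [min_mul_of_nonneg _ _ (hp'_pos w).le, one_mul, div_mul_cancel₀ _ (hp'_pos w).ne']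
    simp only [hacc]
    rw [← integral_const_mul]
    exact integral_mono (hmin.const_mul _) (hp'_int.inf (hp_int.const_mul R))
      fun w => min_one_mul_min_le hR (hp_nonneg w) (hp'_pos w).le
  · rw [hPmeas, hP'meas, tvDist_withDensity_ofReal ν hp_meas hp'_meas hp_nonneg
      (fun w => (hp'_pos w).le) hp_int hp'_int (hp_dens.trans hp'_dens.symm), hp_dens,
      sub_sub_cancel]
end

section
/- Let π be a positive prior density on [0,∞) and suppose there exists λ₀ > 0 such that π(λ') < π(λ) whenever λ' > λ > λ₀. Fix x ≥ 0 and define the (unnormalized) posterior density with Poisson likelihood p(λ) := π(λ)·e^{−λ}·λ^x. Then there exist α > 0 and Λ > 0 such that for all λ' > λ > Λ, log p(λ) − log p(λ') ≥ α·(λ' − λ). (In fact one may take α = 1/2 and Λ = max{λ₀, 2x}.) -/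
theorem Real.mul_log_sub_log_le_half {x a b : ℝ} (hx : 0 ≤ x) (ha : 0 < a) (hxa : 2 * x ≤ a)
    (hab : a ≤ b) : x * (Real.log b - Real.log a) ≤ (1 / 2) * (b - a) := by
  have hb : 0 < b := ha.trans_le hab
  have hlog : Real.log b - Real.log a ≤ (b - a) / a := by
    rw [← Real.log_div hb.ne' ha.ne', sub_div, div_self ha.ne']
    exact Real.log_le_sub_one_of_pos (div_pos hb ha)
  calc x * (Real.log b - Real.log a) ≤ x * ((b - a) / a) := by gcongr
    _ = x / a * (b - a) := by ring
    _ ≤ (1 / 2) * (b - a) := by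
      refine mul_le_mul_of_nonneg_right ?_ (sub_nonneg.mpr hab)
      rw [div_le_iff₀ ha]
      linarith

theorem Real.log_mul_exp_neg_mul_rpow {c a : ℝ} (hc : 0 < c) (ha : 0 < a) (x : ℝ) :
    Real.log (c * Real.exp (-a) * a ^ x) = Real.log c - a + x * Real.log a := by
  rw [Real.log_mul (by positivity) (by positivity), Real.log_mul (by positivity) (by positivity),
    Real.log_exp, Real.log_rpow ha]
  ring

/-- **Exponential right-tail of the posterior with Poisson likelihood.**
If the prior density `pr` is eventually decreasing, then the unnormalized posterior
`p λ = pr λ · e^{−λ} · λ^x` has an exponentially decaying right tail; in fact one may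
take `α = 1/2` and `Λ = max{λ₀, 2x}`. -/
theorem poisson_posterior_exponential_tail
    (pr : ℝ → ℝ) (hpr_pos : ∀ lam : ℝ, 0 ≤ lam → 0 < pr lam)
    (lam₀ : ℝ) (hlam₀ : 0 < lam₀)
    (hdec : ∀ lam lam' : ℝ, lam₀ < lam → lam < lam' → pr lam' < pr lam)
    (x : ℝ) (hx : 0 ≤ x)
    (p : ℝ → ℝ) (hp : ∀ lam : ℝ, p lam = pr lam * Real.exp (-lam) * lam ^ x) :
    (∃ α : ℝ, 0 < α ∧ ∃ Λ : ℝ, 0 < Λ ∧ ∀ lam lam' : ℝ, Λ < lam → lam < lam' →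
      Real.log (p lam) - Real.log (p lam') ≥ α * (lam' - lam)) ∧
    (∀ lam lam' : ℝ, max lam₀ (2 * x) < lam → lam < lam' →
      Real.log (p lam) - Real.log (p lam') ≥ (1 / 2) * (lam' - lam)) := by
  have tail : ∀ lam lam' : ℝ, max lam₀ (2 * x) < lam → lam < lam' →
      Real.log (p lam) - Real.log (p lam') ≥ (1 / 2) * (lam' - lam) := by
    intro lam lam' hlam hlt
    obtain ⟨h₀, h₁⟩ := max_lt_iff.mp hlam
    have hpos : 0 < lam := hlam₀.trans h₀
    have hpos' : 0 < lam' := hpos.trans hlt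
    have hpr' := hpr_pos lam' hpos'.le
    rw [hp, hp, Real.log_mul_exp_neg_mul_rpow (hpr_pos lam hpos.le) hpos,
      Real.log_mul_exp_neg_mul_rpow hpr' hpos']
    have hprior := Real.log_lt_log hpr' (hdec lam lam' h₀ hlt)
    have hpow := Real.mul_log_sub_log_le_half hx hpos h₁.le hlt.le
    linarith
  exact ⟨⟨1 / 2, by norm_num, max lam₀ (2 * x), lt_max_of_lt_left hlam₀, tail⟩, tail⟩
end

section
/- Let μ be a σ-finite measure on a measurable space 𝒳, h : 𝒳 → [0,∞) measurable with μ₁ := h·μ a nonzero finite measure, and T : 𝒳 → ℝ measurable and μ₁-essentially bounded, with M₁ := esssup_{μ₁} T. Assume ∫ h(x) e^{θ·T(x)} μ(dx) < ∞ for every θ ∈ ℝ, and let p_θ(x) := h(x) e^{θ·T(x) − η(θ)} with η(θ) := log ∫ h e^{θT} dμ. Then: (a) for every ε > 0, the probability (p_θ·μ)({x : T(x) ≤ M₁ − ε}) → 0 as θ → +∞; and (b) ∫ T(x) p_θ(x) μ(dx) → M₁ as θ → +∞. -/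
open MeasureTheory

open Filter Topology

section EssSup

variable {Ω : Type*} [MeasurableSpace Ω] {ν : Measure Ω} {T : Ω → ℝ} {B : ℝ}

lemma ae_le_essSup_of_ae_abs_le (hB : ∀ᵐ x ∂ν, |T x| ≤ B) : ∀ᵐ x ∂ν, T x ≤ essSup T ν :=
  _root_.ae_le_essSup ⟨B, eventually_map.2 (hB.mono fun _ hx => (abs_le.1 hx).2)⟩

lemma measure_lt_ne_zero_of_lt_essSup (hν : ν ≠ 0) (hB : ∀ᵐ x ∂ν, |T x| ≤ B) {b : ℝ}
    (hb : b < essSup T ν) : ν {x | b < T x} ≠ 0 := by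
  intro h0
  have hle : ∀ᵐ x ∂ν, T x ≤ b := by
    rw [ae_iff]
    simpa only [not_le] using h0
  have : NeBot (ae ν) := ae_neBot.2 hν
  have hcob : IsCoboundedUnder (· ≤ ·) (ae ν) T :=
    IsBoundedUnder.isCoboundedUnder_le
      ⟨-B, eventually_map.2 (hB.mono fun _ hx => (abs_le.1 hx).1)⟩
  exact hb.not_ge (limsup_le_of_le hcob hle)

variable [IsFiniteMeasure ν]

lemma integrable_exp_mul_of_ae_abs_le (hT : Measurable T) (hB : ∀ᵐ x ∂ν, |T x| ≤ B) (t : ℝ) :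
    Integrable (fun x => Real.exp (t * T x)) ν := by
  refine Integrable.of_bound (by fun_prop) (Real.exp (|t| * B)) (hB.mono fun x hx => ?_)
  rw [Real.norm_eq_abs, Real.abs_exp, Real.exp_le_exp]
  calc t * T x ≤ |t * T x| := le_abs_self _
    _ = |t| * |T x| := abs_mul _ _
    _ ≤ |t| * B := by gcongr

/-- Laplace-type bound for the mass that an exponential tilting gives to a sublevel set. -/
lemma tilted_real_sublevel_le (hT : Measurable T) (hB : ∀ᵐ x ∂ν, |T x| ≤ B) {a b t : ℝ}
    (ht : 0 ≤ t) (hpos : ν {x | b < T x} ≠ 0) :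
    (ν.tilted fun x => t * T x).real {x | T x ≤ a} ≤
      ν.real Set.univ / ν.real {x | b < T x} * Real.exp (-(t * (b - a))) := by
  have hint := integrable_exp_mul_of_ae_abs_le hT hB t
  have hsa : MeasurableSet {x | T x ≤ a} := measurableSet_le hT measurable_const
  have hsb : MeasurableSet {x | b < T x} := measurableSet_lt measurable_const hT
  have hc : 0 < ν.real {x | b < T x} := ENNReal.toReal_pos hpos (measure_ne_top _ _)
  have hZ : Real.exp (t * b) * ν.real {x | b < T x} ≤ ∫ x, Real.exp (t * T x) ∂ν := by
    calc Real.exp (t * b) * ν.real {x | b < T x}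
        = ∫ _ in {x | b < T x}, Real.exp (t * b) ∂ν := by
          rw [setIntegral_const, smul_eq_mul, mul_comm]
      _ ≤ ∫ x in {x | b < T x}, Real.exp (t * T x) ∂ν := by
          refine setIntegral_mono_on (integrable_const _) hint.integrableOn hsb fun x hx => ?_
          exact Real.exp_le_exp.2 (mul_le_mul_of_nonneg_left (le_of_lt hx) ht)
      _ ≤ _ := setIntegral_le_integral hint (ae_of_all _ fun _ => (Real.exp_pos _).le)
  have hN : ∫ x in {x | T x ≤ a}, Real.exp (t * T x) ∂ν ≤ Real.exp (t * a) * ν.real Set.univ := by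
    calc ∫ x in {x | T x ≤ a}, Real.exp (t * T x) ∂ν
        ≤ ∫ _ in {x | T x ≤ a}, Real.exp (t * a) ∂ν := by
          refine setIntegral_mono_on hint.integrableOn (integrable_const _) hsa fun x hx => ?_
          exact Real.exp_le_exp.2 (mul_le_mul_of_nonneg_left hx ht)
      _ = Real.exp (t * a) * ν.real {x | T x ≤ a} := by
          rw [setIntegral_const, smul_eq_mul, mul_comm]
      _ ≤ _ := by gcongr; exacts [measure_ne_top _ _, Set.subset_univ _]
  rw [Measure.real, tilted_apply_eq_ofReal_integral' _ hsa, integral_div, ENNReal.toReal_ofReal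
    (div_nonneg (setIntegral_nonneg hsa fun _ _ => (Real.exp_pos _).le)
      (integral_nonneg fun _ => (Real.exp_pos _).le))]
  calc _ ≤ Real.exp (t * a) * ν.real Set.univ / (Real.exp (t * b) * ν.real {x | b < T x}) :=
        div_le_div₀ (by positivity) hN (by positivity) hZ
    _ = _ := by
        rw [show -(t * (b - a)) = t * a - t * b by ring, Real.exp_sub]
        field_simp

lemma tendsto_tilted_real_sublevel (hν : ν ≠ 0) (hT : Measurable T) (hB : ∀ᵐ x ∂ν, |T x| ≤ B)
    {ε : ℝ} (hε : 0 < ε) :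
    Tendsto (fun t : ℝ => (ν.tilted fun x => t * T x).real {x | T x ≤ essSup T ν - ε})
      atTop (𝓝 0) := by
  have hpos : ν {x | essSup T ν - ε / 2 < T x} ≠ 0 :=
    measure_lt_ne_zero_of_lt_essSup hν hB (by linarith)
  have hexp : Tendsto (fun t : ℝ => Real.exp (-(t * (essSup T ν - ε / 2 - (essSup T ν - ε)))))
      atTop (𝓝 0) :=
    Real.tendsto_exp_neg_atTop_nhds_zero.comp (tendsto_id.atTop_mul_const (by linarith))
  have hlim := hexp.const_mul (ν.real Set.univ / ν.real {x | essSup T ν - ε / 2 < T x})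
  rw [mul_zero] at hlim
  exact tendsto_of_tendsto_of_tendsto_of_le_of_le' tendsto_const_nhds hlim
    (Eventually.of_forall fun _ => measureReal_nonneg)
    ((eventually_ge_atTop 0).mono fun t ht => tilted_real_sublevel_le hT hB ht hpos)

lemma tendsto_integral_tilted_essSup (hν : ν ≠ 0) (hT : Measurable T)
    (hB : ∀ᵐ x ∂ν, |T x| ≤ B) :
    Tendsto (fun t : ℝ => ∫ x, T x ∂(ν.tilted fun x => t * T x)) atTop (𝓝 (essSup T ν)) := by
  set M := essSup T ν
  have : NeZero ν := ⟨hν⟩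
  have hprob (t : ℝ) : IsProbabilityMeasure (ν.tilted fun x => t * T x) :=
    isProbabilityMeasure_tilted (integrable_exp_mul_of_ae_abs_le hT hB t)
  have hBt (t : ℝ) : ∀ᵐ x ∂(ν.tilted fun x => t * T x), |T x| ≤ B :=
    (tilted_absolutelyContinuous ν _).ae_le hB
  have hMt (t : ℝ) : ∀ᵐ x ∂(ν.tilted fun x => t * T x), T x ≤ M :=
    (tilted_absolutelyContinuous ν _).ae_le (ae_le_essSup_of_ae_abs_le hB)
  have hTint (t : ℝ) : Integrable T (ν.tilted fun x => t * T x) :=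
    Integrable.of_bound hT.aestronglyMeasurable B (hBt t)
  have upper (t : ℝ) : ∫ x, T x ∂(ν.tilted fun x => t * T x) ≤ M := by
    simpa using integral_mono_ae (hTint t) (integrable_const M) (hMt t)
  have lower (ε : ℝ) (hε : 0 < ε) (t : ℝ) :
      M - ε - |M + B| * (ν.tilted fun x => t * T x).real {x | T x ≤ M - ε} ≤
        ∫ x, T x ∂(ν.tilted fun x => t * T x) := by
    have hs : MeasurableSet {x | T x ≤ M - ε} := measurableSet_le hT measurable_const
    have hind : Integrable ({x | T x ≤ M - ε}.indicator fun _ => |M + B|)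
        (ν.tilted fun x => t * T x) := (integrable_const _).indicator hs
    have hmono : ∫ x, (M - ε - {x | T x ≤ M - ε}.indicator (fun _ => |M + B|) x)
        ∂(ν.tilted fun x => t * T x) ≤ ∫ x, T x ∂(ν.tilted fun x => t * T x) := by
      refine integral_mono_ae ((integrable_const _).sub hind) (hTint t) ((hBt t).mono fun x hx => ?_)
      by_cases hxs : T x ≤ M - ε
      · have hx' : x ∈ {x | T x ≤ M - ε} := hxs
        simp only [Set.indicator_of_mem hx']
        linarith [le_abs_self (M + B), (abs_le.1 hx).1]
      · have hx' : x ∉ {x | T x ≤ M - ε} := hxs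
        simp only [Set.indicator_of_notMem hx']
        linarith
    rw [integral_sub (integrable_const _) hind, integral_indicator_const _ hs] at hmono
    simpa [mul_comm] using hmono
  refine tendsto_order.2 ⟨fun m hm => ?_, fun m hm =>
    Eventually.of_forall fun t => (upper t).trans_lt hm⟩
  have hε : 0 < (M - m) / 2 := by linarith
  have hlim := ((tendsto_tilted_real_sublevel hν hT hB hε).const_mul |M + B|).const_sub
    (M - (M - m) / 2)
  rw [mul_zero, sub_zero] at hlim
  exact (hlim.eventually (lt_mem_nhds (by linarith))).mono fun t ht =>
    ht.trans_le (lower _ hε t)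

end EssSup

lemma withDensity_tilted_eq_withDensity_exp_sub_log {Ω : Type*} [MeasurableSpace Ω]
    {μ : Measure Ω} {h f : Ω → ℝ} (hh : Measurable h) (h0 : ∀ x, 0 ≤ h x) (hf : Measurable f)
    (hZ : 0 < ∫ x, h x * Real.exp (f x) ∂μ) :
    (μ.withDensity fun x => ENNReal.ofReal (h x)).tilted f =
      μ.withDensity fun x => ENNReal.ofReal
        (h x * Real.exp (f x - Real.log (∫ y, h y * Real.exp (f y) ∂μ))) := by
  rw [Measure.tilted, ← withDensity_mul _ (by fun_prop) (by fun_prop),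
    integral_withDensity_eq_integral_toReal_smul (by fun_prop) (by simp)]
  congr 1
  ext x
  simp only [Pi.mul_apply, smul_eq_mul, ENNReal.toReal_ofReal (h0 _)]
  rw [← ENNReal.ofReal_mul (h0 x), Real.exp_sub, Real.exp_log hZ]

/-- **Concentration of an exponential family near the essential supremum of its
sufficient statistic as `θ → ∞`:** the mass of `{T ≤ M₁ − ε}` vanishes and the mean
of `T` tends to `M₁ = esssup_{μ₁} T`. -/
theorem expFamily_tendsto_essSup
    {𝒳 : Type*} [MeasurableSpace 𝒳] (μ : Measure 𝒳) [SigmaFinite μ]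
    (h : 𝒳 → ℝ) (hh_meas : Measurable h) (hh_nonneg : ∀ x, 0 ≤ h x)
    (μ₁ : Measure 𝒳) (hμ₁ : μ₁ = μ.withDensity (fun x => ENNReal.ofReal (h x)))
    (hμ₁_ne : μ₁ ≠ 0) (hμ₁_fin : IsFiniteMeasure μ₁)
    (T : 𝒳 → ℝ) (hT_meas : Measurable T)
    (Tbd : ℝ) (hTbd : ∀ᵐ x ∂μ₁, |T x| ≤ Tbd)
    (hint : ∀ t : ℝ, Integrable (fun x => h x * Real.exp (t * T x)) μ)
    (η : ℝ → ℝ)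
    (hη : ∀ t : ℝ, η t = Real.log (∫ x, h x * Real.exp (t * T x) ∂μ))
    (pdens : ℝ → 𝒳 → ℝ)
    (hpdens : ∀ t x, pdens t x = h x * Real.exp (t * T x - η t))
    (M₁ : ℝ) (hM₁ : M₁ = essSup T μ₁)
    (Pm : ℝ → Measure 𝒳)
    (hPm : ∀ t : ℝ, Pm t = μ.withDensity (fun x => ENNReal.ofReal (pdens t x))) :
    (∀ ε : ℝ, 0 < ε →
      Filter.Tendsto (fun t : ℝ => Pm t {x : 𝒳 | T x ≤ M₁ - ε})
        Filter.atTop (nhds 0)) ∧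
    Filter.Tendsto (fun t : ℝ => ∫ x, T x * pdens t x ∂μ)
      Filter.atTop (nhds M₁) := by
  subst hM₁
  have hZ (t : ℝ) : 0 < ∫ x, h x * Real.exp (t * T x) ∂μ := by
    have : NeZero μ₁ := ⟨hμ₁_ne⟩
    have hpos := integral_exp_pos (integrable_exp_mul_of_ae_abs_le hT_meas hTbd t)
    rw [hμ₁, integral_withDensity_eq_integral_toReal_smul (by fun_prop) (by simp)] at hpos
    simpa only [smul_eq_mul, ENNReal.toReal_ofReal (hh_nonneg _)] using hpos
  have hPm_tilted (t : ℝ) : Pm t = μ₁.tilted fun x => t * T x := by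
    rw [hPm, hμ₁, withDensity_tilted_eq_withDensity_exp_sub_log hh_meas hh_nonneg
      (hT_meas.const_mul t) (hZ t)]
    simp only [hpdens, hη]
  constructor
  · intro ε hε
    simp only [hPm_tilted]
    have hlim := ENNReal.tendsto_ofReal
      (tendsto_tilted_real_sublevel hμ₁_ne hT_meas hTbd hε)
    rw [ENNReal.ofReal_zero] at hlim
    exact hlim.congr fun t => ofReal_measureReal (measure_ne_top _ _)
  · refine (tendsto_integral_tilted_essSup hμ₁_ne hT_meas hTbd).congr fun t => ?_
    have hp : Measurable (pdens t) := by
      rw [funext (hpdens t)]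
      fun_prop
    have hp0 (x : 𝒳) : 0 ≤ pdens t x := by
      rw [hpdens]
      exact mul_nonneg (hh_nonneg x) (Real.exp_pos _).le
    rw [← hPm_tilted, hPm, integral_withDensity_eq_integral_toReal_smul (by fun_prop) (by simp)]
    simp only [smul_eq_mul, ENNReal.toReal_ofReal (hp0 _), mul_comm]
end

section
/- Let π be a positive prior density on ℝ satisfying condition (Ã1). Let μ be a σ-finite measure on a measurable space 𝒳, h : 𝒳 → [0,∞) measurable with μ₁ := h·μ a nonzero finite measure, and T : 𝒳 → ℝ measurable and μ₁-essentially bounded, with m₁ := essinf_{μ₁} T and M₁ := esssup_{μ₁} T. Assume ∫ h(x) e^{θ·T(x)} μ(dx) < ∞ for every θ ∈ ℝ, and set η(θ) := log ∫ h e^{θT} dμ. Fix an observation x ∈ 𝒳 with m₁ ≤ T(x) ≤ M₁. Then the (unnormalized) posterior density π̄(θ) := π(θ)·e^{θ·T(x) − η(θ)} on ℝ also satisfies condition (Ã1): there exist α' > 0 and x₁' > 0 such that log π̄(u) − log π̄(v) ≥ α'(v − u) for all v > u > x₁', and log π̄(u) − log π̄(v) ≥ α'(u − v) for all v < u < −x₁'.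 -/
open MeasureTheory

open ProbabilityTheory in
/-- The cumulant-generating function is convex on its domain of finiteness. -/
theorem convexOn_cgf {Ω : Type*} [MeasurableSpace Ω] (X : Ω → ℝ) (μ : Measure Ω) :
    ConvexOn ℝ (integrableExpSet X μ) (cgf X μ) := by
  refine ⟨convex_integrableExpSet, fun s hs t ht a b ha hb hab => ?_⟩
  rcases eq_or_ne μ 0 with rfl | hμ
  · simp
  have : NeZero μ := ⟨hμ⟩
  have hst : Integrable (fun ω => Real.exp ((a * s + b * t) * X ω)) μ :=
    convex_integrableExpSet hs ht ha hb hab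
  have hnorm (r : ℝ) (hr : r ∈ integrableExpSet X μ) :
      ∫ ω, Real.exp (r * X ω) * Real.exp (-cgf X μ r) ∂μ = 1 := by
    have hexp := exp_cgf (X := X) (μ := μ) hr
    rw [integral_mul_const, ← mgf, ← hexp, ← Real.exp_add, add_neg_cancel, Real.exp_zero]
  have hle : ∫ ω, Real.exp ((a * s + b * t) * X ω)
        * Real.exp (-(a * cgf X μ s + b * cgf X μ t)) ∂μ
      ≤ ∫ ω, (a * (Real.exp (s * X ω) * Real.exp (-cgf X μ s))
        + b * (Real.exp (t * X ω) * Real.exp (-cgf X μ t))) ∂μ := by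
    refine integral_mono (hst.mul_const _)
      (((hs.mul_const _).const_mul a).add ((ht.mul_const _).const_mul b)) fun ω => ?_
    have hconv := convexOn_exp.2 (Set.mem_univ (s * X ω + -cgf X μ s))
      (Set.mem_univ (t * X ω + -cgf X μ t)) ha hb hab
    simp only [smul_eq_mul, Real.exp_add] at hconv
    refine le_trans (le_of_eq ?_) hconv
    simp only [← Real.exp_add]
    congr 1
    ring
  rw [integral_add ((hs.mul_const _).const_mul a) ((ht.mul_const _).const_mul b),
    integral_const_mul, integral_const_mul, hnorm s hs, hnorm t ht, mul_one, mul_one, hab,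
    integral_mul_const, ← mgf, ← exp_cgf hst, ← Real.exp_add, Real.exp_le_one_iff] at hle
  simp only [smul_eq_mul]
  linarith

open ProbabilityTheory in
/-- If `X` exceeds `c` with positive mass, the increments of its cumulant-generating function
eventually dominate those of any linear function with slope smaller than `c`. -/
theorem exists_forall_mul_sub_le_cgf_sub {Ω : Type*} [MeasurableSpace Ω] {X : Ω → ℝ}
    {μ : Measure Ω} [IsFiniteMeasure μ] (hX : ∀ t : ℝ, Integrable (fun ω => Real.exp (t * X ω)) μ)
    {b c : ℝ} (hbc : b < c) (hc : μ {ω | c ≤ X ω} ≠ 0) :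
    ∃ K : ℝ, 0 < K ∧ ∀ u v : ℝ, K < u → u < v → b * (v - u) ≤ cgf X μ v - cgf X μ u := by
  set p := μ.real {ω | c ≤ X ω}
  have hp_pos : 0 < p := ENNReal.toReal_pos hc (measure_ne_top _ _)
  set D := |Real.log p - cgf X μ 0|
  refine ⟨D / (c - b) + 1, by have := sub_pos.2 hbc; positivity, fun u v hu huv => ?_⟩
  have hcb := sub_pos.2 hbc
  have hu_pos : 0 < u := lt_trans (by positivity) hu
  have htail : Real.log p ≤ -u * c + cgf X μ u :=
    (Real.log_le_iff_le_exp hp_pos).2 (measure_ge_le_exp_cgf c hu_pos.le (hX u))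
  have hD : D ≤ u * (c - b) := by
    rw [← div_le_iff₀ hcb]
    linarith
  have hslope : b ≤ (cgf X μ u - cgf X μ 0) / (u - 0) := by
    rw [sub_zero, le_div_iff₀ hu_pos]
    linarith [neg_abs_le (Real.log p - cgf X μ 0)]
  have hmono := (convexOn_cgf X μ).slope_mono_adjacent (hX 0) (hX v) hu_pos huv
  exact (le_div_iff₀ (sub_pos.2 huv)).1 (hslope.trans hmono)

/-- A function bounded below almost everywhere attains values `≥ c` with positive mass, for every
`c` below its essential supremum. -/
theorem measure_le_ne_zero_of_lt_essSup {Ω : Type*} [MeasurableSpace Ω] {X : Ω → ℝ}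
    {μ : Measure Ω} (hμ : μ ≠ 0) {B c : ℝ} (hB : ∀ᵐ ω ∂μ, B ≤ X ω) (hc : c < essSup X μ) :
    μ {ω | c ≤ X ω} ≠ 0 := by
  intro h0
  have : (ae μ).NeBot := ae_neBot.2 hμ
  have hbdd : Filter.IsBoundedUnder (· ≥ ·) (ae μ) X := ⟨B, Filter.eventually_map.2 hB⟩
  have hlt : ∀ᵐ ω ∂μ, X ω ≤ c := by
    filter_upwards [measure_eq_zero_iff_ae_notMem.1 h0] with ω hω
    exact (not_le.1 hω).le
  exact hc.not_ge (essSup_le_of_ae_le c hlt hbdd.isCoboundedUnder_le)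

/-- A function bounded above almost everywhere attains values `≤ c` with positive mass, for every
`c` above its essential infimum. -/
theorem measure_ge_ne_zero_of_essInf_lt {Ω : Type*} [MeasurableSpace Ω] {X : Ω → ℝ}
    {μ : Measure Ω} (hμ : μ ≠ 0) {B c : ℝ} (hB : ∀ᵐ ω ∂μ, X ω ≤ B) (hc : essInf X μ < c) :
    μ {ω | X ω ≤ c} ≠ 0 := by
  intro h0
  have : (ae μ).NeBot := ae_neBot.2 hμ
  have hbdd : Filter.IsBoundedUnder (· ≤ ·) (ae μ) X := ⟨B, Filter.eventually_map.2 hB⟩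
  have hlt : ∀ᵐ ω ∂μ, c ≤ X ω := by
    filter_upwards [measure_eq_zero_iff_ae_notMem.1 h0] with ω hω
    exact (not_le.1 hω).le
  exact hc.not_ge (le_essInf_of_ae_le c hlt hbdd.isCoboundedUnder_ge)

/-- **The posterior from an exponential-family likelihood with bounded sufficient
statistic inherits condition (Ã1) from the prior.** -/
theorem expFamily_posterior_inherits_A1
    {𝒳 : Type*} [MeasurableSpace 𝒳] (μ : Measure 𝒳) [SigmaFinite μ]
    -- the prior and condition (Ã1) for it
    (pr : ℝ → ℝ) (hpr_pos : ∀ θ : ℝ, 0 < pr θ)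
    (α x₁ : ℝ) (hα : 0 < α) (hx₁ : 0 < x₁)
    (hA1_right : ∀ u v : ℝ, x₁ < u → u < v →
      Real.log (pr u) - Real.log (pr v) ≥ α * (v - u))
    (hA1_left : ∀ u v : ℝ, v < u → u < -x₁ →
      Real.log (pr u) - Real.log (pr v) ≥ α * (u - v))
    -- the exponential family
    (h : 𝒳 → ℝ) (hh_meas : Measurable h) (hh_nonneg : ∀ x, 0 ≤ h x)
    (μ₁ : Measure 𝒳) (hμ₁ : μ₁ = μ.withDensity (fun x => ENNReal.ofReal (h x)))
    (hμ₁_ne : μ₁ ≠ 0) (hμ₁_fin : IsFiniteMeasure μ₁)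
    (T : 𝒳 → ℝ) (hT_meas : Measurable T)
    (Tbd : ℝ) (hTbd : ∀ᵐ x ∂μ₁, |T x| ≤ Tbd)
    (m₁ M₁ : ℝ) (hm₁ : m₁ = essInf T μ₁) (hM₁ : M₁ = essSup T μ₁)
    (hint : ∀ t : ℝ, Integrable (fun x => h x * Real.exp (t * T x)) μ)
    (η : ℝ → ℝ)
    (hη : ∀ t : ℝ, η t = Real.log (∫ x, h x * Real.exp (t * T x) ∂μ))
    -- the observation and the (unnormalized) posterior density
    (x : 𝒳) (hxT : m₁ ≤ T x ∧ T x ≤ M₁)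
    (πbar : ℝ → ℝ)
    (hπbar : ∀ θ : ℝ, πbar θ = pr θ * Real.exp (θ * T x - η θ)) :
    ∃ α' : ℝ, 0 < α' ∧ ∃ x₁' : ℝ, 0 < x₁' ∧
      (∀ u v : ℝ, x₁' < u → u < v →
        Real.log (πbar u) - Real.log (πbar v) ≥ α' * (v - u)) ∧
      (∀ u v : ℝ, v < u → u < -x₁' →
        Real.log (πbar u) - Real.log (πbar v) ≥ α' * (u - v)) := by
  have hdens : Measurable fun y => ENNReal.ofReal (h y) := hh_meas.ennreal_ofReal
  have hfin : ∀ᵐ y ∂μ, ENNReal.ofReal (h y) < ⊤ := ae_of_all _ fun _ => ENNReal.ofReal_lt_top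
  have hint₁ (t : ℝ) : Integrable (fun y => Real.exp (t * T y)) μ₁ := by
    rw [hμ₁, integrable_withDensity_iff_integrable_smul' hdens hfin]
    simpa only [ENNReal.toReal_ofReal (hh_nonneg _), smul_eq_mul] using hint t
  have hη_cgf (t : ℝ) : η t = ProbabilityTheory.cgf T μ₁ t := by
    rw [hη, ProbabilityTheory.cgf, ProbabilityTheory.mgf, hμ₁,
      integral_withDensity_eq_integral_toReal_smul hdens hfin]
    simp only [ENNReal.toReal_ofReal (hh_nonneg _), smul_eq_mul]
  have hlog (θ : ℝ) :
      Real.log (πbar θ) = Real.log (pr θ) + (θ * T x - ProbabilityTheory.cgf T μ₁ θ) := by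
    rw [hπbar, Real.log_mul (hpr_pos θ).ne' (Real.exp_ne_zero _), Real.log_exp, hη_cgf]
  have hsup : μ₁ {y | T x - α / 4 ≤ T y} ≠ 0 :=
    measure_le_ne_zero_of_lt_essSup hμ₁_ne (hTbd.mono fun _ hy => (abs_le.1 hy).1)
      (by rw [← hM₁]; linarith [hxT.2])
  have hinf : μ₁ {y | -T x - α / 4 ≤ (-T) y} ≠ 0 := by
    have := measure_ge_ne_zero_of_essInf_lt (c := T x + α / 4) hμ₁_ne
      (hTbd.mono fun _ hy => (abs_le.1 hy).2) (by rw [← hm₁]; linarith [hxT.1])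
    convert this using 4 with y
    simp only [Pi.neg_apply]
    constructor <;> intro <;> linarith
  obtain ⟨K, hK, hright⟩ := exists_forall_mul_sub_le_cgf_sub hint₁
    (b := T x - α / 2) (by linarith) hsup
  obtain ⟨L, hL, hleft⟩ := exists_forall_mul_sub_le_cgf_sub (X := -T)
    (fun t => by simpa using hint₁ (-t)) (b := -T x - α / 2) (by linarith) hinf
  refine ⟨α / 2, half_pos hα, max x₁ (max K L), lt_max_of_lt_left hx₁,
    fun u v hu huv => ?_, fun u v hvu hu => ?_⟩
  · obtain ⟨hu₁, huK, -⟩ := by simpa only [max_lt_iff] using hu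
    rw [hlog, hlog]
    linarith [hA1_right u v hu₁ huv, hright u v huK huv]
  · obtain ⟨hu₁, -, huL⟩ := by simpa only [max_lt_iff] using lt_neg.1 hu
    have hincr := hleft (-u) (-v) huL (neg_lt_neg hvu)
    rw [ProbabilityTheory.cgf_neg, ProbabilityTheory.cgf_neg, neg_neg, neg_neg] at hincr
    rw [hlog, hlog]
    linarith [hA1_left u v hvu (lt_neg.1 hu₁)]
end
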